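/- Let k ≥ 2, let f : (k+1)^V → ℝ be a nonnegative k-submodular function (not necessarily monotone) with f(0) = 0, and let c be a cost function on V. Let o ∈ (k+1)^V with c(o) > 0 and let 0 = s^{(0)} ⪯ s^{(1)} ⪯ … ⪯ s^{(m)} = s be a greedy sequence relative to o. If β = c(s)/c(o), then f(s) ≥ min{β/3, 1/3}·f(o). -/

import Mathlib

open Finset

section KSubmodularDefs

variable {V : Type*} [Fintype V] [DecidableEq V] {k : ℕ}

/-- The support of a `k`-tuple `x : V → Fin (k+1)` (value `0` means "not selected"). -/
def ksupp (x : V → Fin (k+1)) : Finset V := Finset.univ.filter fun e => x e ≠ 0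

/-- The meet `x ⊓ y`. -/
def kinf (x y : V → Fin (k+1)) : V → Fin (k+1) :=
  fun e => if x e = y e then x e else 0

/-- The join `x ⊔ y`. -/
def ksup (x y : V → Fin (k+1)) : V → Fin (k+1) :=
  fun e => if y e = 0 ∨ y e = x e then x e else if x e = 0 then y e else 0

/-- `f` is `k`-submodular. -/
def KSubmodular (f : (V → Fin (k+1)) → ℝ) : Prop :=
  ∀ x y : V → Fin (k+1), f (ksup x y) + f (kinf x y) ≤ f x + f y

/-- The partial order `x ⪯ y` on `(k+1)^V`. -/
def kle (x y : V → Fin (k+1)) : Prop := ∀ e : V, x e = 0 ∨ x e = y e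

/-- `f` is monotone with respect to `⪯`. -/
def KMonotone (f : (V → Fin (k+1)) → ℝ) : Prop :=
  ∀ x y : V → Fin (k+1), kle x y → f x ≤ f y

/-- The marginal gain `Δ_{e,j}(x)` of assigning element `e` to component `j`. -/
def margin (f : (V → Fin (k+1)) → ℝ) (x : V → Fin (k+1)) (e : V) (j : Fin (k+1)) : ℝ :=
  f (Function.update x e j) - f x

/-- The total cost `c(x)` of a tuple. -/
def kcost (c : V → ℝ) (x : V → Fin (k+1)) : ℝ := ∑ e ∈ ksupp x, c e

/-- One step of a greedy sequence relative to `o`: pick `e ∉ supp x` and `j ∈ {1,…,k}`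
maximizing the marginal gain over components (a), and with marginal density at least that of
every pair `(e', j')` with `e' ∈ supp o \ supp x` (b). -/
def GreedyStep (f : (V → Fin (k+1)) → ℝ) (c : V → ℝ) (o : V → Fin (k+1))
    (x x' : V → Fin (k+1)) : Prop :=
  ∃ e : V, ∃ j : Fin (k+1), x e = 0 ∧ j ≠ 0 ∧ x' = Function.update x e j ∧
    (∀ j' : Fin (k+1), j' ≠ 0 → margin f x e j' ≤ margin f x e j) ∧
    (∀ e' : V, o e' ≠ 0 → x e' = 0 → ∀ j' : Fin (k+1), j' ≠ 0 →
      margin f x e' j' * c e ≤ margin f x e j * c e')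

/-- `GreedyRun f c B s V0 out`: starting from partial solution `s` with remaining elements `V0`,
the greedy procedure with budget `B` (under some tie-breaking) can terminate with output `out`.
At each step a pair `(e, j)` of maximum marginal density among remaining elements is chosen;
`e` is added (placed in component `j`) iff it fits in the remaining budget, and is removed
from the remaining pool in either case. -/
inductive GreedyRun (f : (V → Fin (k+1)) → ℝ) (c : V → ℝ) (B : ℝ) :
    (V → Fin (k+1)) → Finset V → (V → Fin (k+1)) → Prop where
  | done (s : V → Fin (k+1)) : GreedyRun f c B s ∅ s
  | take (s : V → Fin (k+1)) (V0 : Finset V) (e : V) (j : Fin (k+1))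
      (out : V → Fin (k+1)) (he : e ∈ V0) (hj : j ≠ 0)
      (hbest : ∀ e' ∈ V0, ∀ j' : Fin (k+1), j' ≠ 0 →
        margin f s e' j' / c e' ≤ margin f s e j / c e)
      (hfit : kcost c s + c e ≤ B)
      (hrest : GreedyRun f c B (Function.update s e j) (V0.erase e) out) :
      GreedyRun f c B s V0 out
  | skip (s : V → Fin (k+1)) (V0 : Finset V) (e : V) (j : Fin (k+1))
      (out : V → Fin (k+1)) (he : e ∈ V0) (hj : j ≠ 0)
      (hbest : ∀ e' ∈ V0, ∀ j' : Fin (k+1), j' ≠ 0 →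
        margin f s e' j' / c e' ≤ margin f s e j / c e)
      (hnofit : ¬ kcost c s + c e ≤ B)
      (hrest : GreedyRun f c B s (V0.erase e) out) :
      GreedyRun f c B s V0 out

/-- The `k`-multilinear extension of `f`, as a function of `x : V → Fin (k+1) → ℝ`
(only the coordinates `x e j` with `j ≠ 0` are relevant). -/
noncomputable def kext (f : (V → Fin (k+1)) → ℝ) (x : V → Fin (k+1) → ℝ) : ℝ :=
  ∑ s : V → Fin (k+1), f s *
    ∏ e : V,
      (if s e = 0 then 1 - ∑ j ∈ Finset.univ.erase (0 : Fin (k+1)), x e j else x e (s e))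

/-- The partial derivative of `F` with respect to the coordinate `(e, j)` at the point `x`. -/
noncomputable def pderiv (F : (V → Fin (k+1) → ℝ) → ℝ) (e : V) (j : Fin (k+1))
    (x : V → Fin (k+1) → ℝ) : ℝ :=
  deriv (fun t : ℝ => F (Function.update x e (Function.update (x e) j t))) (x e j)

/-- Membership in the domain `Δ_k^V` of the multilinear extension. -/
def inSimplex (x : V → Fin (k+1) → ℝ) : Prop :=
  (∀ e : V, ∀ j : Fin (k+1), j ≠ 0 → 0 ≤ x e j ∧ x e j ≤ 1) ∧
  (∀ e : V, ∑ j ∈ Finset.univ.erase (0 : Fin (k+1)), x e j ≤ 1)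

end KSubmodularDefs

section GreedyRatio

variable {V : Type*} {k : ℕ}

theorem kle.trans {x y z : V → Fin (k+1)} (hxy : kle x y) (hyz : kle y z) : kle x z := by
  intro a
  rcases hxy a with h | h
  · exact Or.inl h
  · rw [h]; exact hyz a

/-- The tuple `o` overridden by `x` on the support of `x`. -/
def koverride (o x : V → Fin (k+1)) : V → Fin (k+1) := fun e => if x e = 0 then o e else x e

theorem kle_koverride (o x : V → Fin (k+1)) : kle x (koverride o x) := by
  intro e
  by_cases h : x e = 0 <;> simp [koverride, h]

variable [DecidableEq V]

theorem margin_anti {f : (V → Fin (k+1)) → ℝ} (hsub : KSubmodular f)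
    {x y : V → Fin (k+1)} (hxy : kle x y) {e : V} (he : y e = 0) (j : Fin (k+1)) :
    margin f y e j ≤ margin f x e j := by
  have hx : x e = 0 := by rcases hxy e with h | h <;> simp [h, he]
  have h := hsub (Function.update x e j) y
  have h1 : ksup (Function.update x e j) y = Function.update y e j := by
    funext a
    by_cases ha : a = e
    · subst ha; simp [ksup, he]
    · rcases hxy a with h | h <;> simp [ksup, ha, h, eq_comm]
  have h2 : kinf (Function.update x e j) y = x := by
    funext a
    by_cases ha : a = e
    · subst ha; simp [kinf, he, hx]
    · rcases hxy a with h | h <;> simp [kinf, ha, h]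
  rw [h1, h2] at h
  unfold margin
  linarith

theorem margin_add_margin_nonneg {f : (V → Fin (k+1)) → ℝ} (hsub : KSubmodular f)
    {x : V → Fin (k+1)} {e : V} (he : x e = 0) {i j : Fin (k+1)}
    (hi : i ≠ 0) (hj : j ≠ 0) (hij : i ≠ j) :
    0 ≤ margin f x e i + margin f x e j := by
  have h := hsub (Function.update x e i) (Function.update x e j)
  have h1 : ksup (Function.update x e i) (Function.update x e j) = x := by
    funext a
    by_cases ha : a = e
    · subst ha; simp [ksup, he, hi, hj, hij.symm]
    · simp [ksup, ha]
  have h2 : kinf (Function.update x e i) (Function.update x e j) = x := by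
    funext a
    by_cases ha : a = e
    · subst ha; simp [kinf, he, hij]
    · simp [kinf, ha]
  rw [h1, h2] at h
  unfold margin
  linarith

theorem kcost_update [Fintype V] (c : V → ℝ) {x : V → Fin (k+1)} {e : V} (he : x e = 0)
    {j : Fin (k+1)} (hj : j ≠ 0) :
    kcost c (Function.update x e j) = kcost c x + c e := by
  have h : ksupp (Function.update x e j) = insert e (ksupp x) := by
    ext a
    by_cases ha : a = e
    · subst ha; simp [ksupp, hj]
    · simp [ksupp, ha]
  have hn : e ∉ ksupp x := by simp [ksupp, he]
  rw [kcost, h, Finset.sum_insert hn, kcost, add_comm]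

theorem exists_ne_zero_ne (hk : 2 ≤ k) (j : Fin (k+1)) : ∃ i : Fin (k+1), i ≠ 0 ∧ i ≠ j := by
  have h : ({0, j} : Finset (Fin (k+1))).card < (Finset.univ : Finset (Fin (k+1))).card := by
    have := Finset.card_le_two (a := (0 : Fin (k+1))) (b := j)
    rw [Finset.card_univ, Fintype.card_fin]
    omega
  obtain ⟨i, -, hi⟩ := Finset.exists_mem_notMem_of_card_lt_card h
  exact ⟨i, by simpa using hi⟩

theorem margin_nonneg_of_max (hk : 2 ≤ k) {f : (V → Fin (k+1)) → ℝ} (hsub : KSubmodular f)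
    {x : V → Fin (k+1)} {e : V} (he : x e = 0) {j : Fin (k+1)} (hj : j ≠ 0)
    (hmax : ∀ j' : Fin (k+1), j' ≠ 0 → margin f x e j' ≤ margin f x e j) :
    0 ≤ margin f x e j := by
  obtain ⟨i, hi, hij⟩ := exists_ne_zero_ne hk j
  linarith [margin_add_margin_nonneg hsub he hi hj hij, hmax i hi]

/-- If all marginal gains at `x` towards `y` have density at most `ρ`, then so does the total gain
from `x` to `y`. -/
theorem le_add_mul_kcost_sub [Fintype V] {f : (V → Fin (k+1)) → ℝ} (hsub : KSubmodular f) (c : V → ℝ)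
    {x y : V → Fin (k+1)} (hxy : kle x y) {ρ : ℝ}
    (hρ : ∀ e, x e = 0 → y e ≠ 0 → margin f x e (y e) ≤ ρ * c e) :
    f y ≤ f x + ρ * (kcost c y - kcost c x) := by
  have key : ∀ T : Finset V, f (T.piecewise y x) ≤
      f x + ρ * (kcost c (T.piecewise y x) - kcost c x) := by
    intro T
    induction T using Finset.induction_on with
    | empty => simp
    | insert a T ha ih =>
      rw [Finset.piecewise_insert]
      have hza : T.piecewise y x a = x a := Finset.piecewise_eq_of_notMem _ _ _ ha
      by_cases h : y a = x a
      · rwa [h, ← hza, Function.update_eq_self]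
      · have hx : x a = 0 := (hxy a).resolve_right fun h' => h h'.symm
        have hy : y a ≠ 0 := fun h' => h (h'.trans hx.symm)
        have hle : kle x (T.piecewise y x) := by
          intro e
          by_cases he : e ∈ T
          · simpa [he] using hxy e
          · simp [he]
        have h1 := margin_anti hsub hle (hza.trans hx) (y a)
        rw [kcost_update c (hza.trans hx) hy]
        have h2 := hρ a hx hy
        rw [margin] at h1
        linarith
  simpa using key Finset.univ

theorem koverride_update (o x : V → Fin (k+1)) (e : V) {j : Fin (k+1)} (hj : j ≠ 0) :
    koverride o (Function.update x e j) = Function.update (koverride o x) e j := by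
  funext a
  by_cases ha : a = e
  · subst ha; simp [koverride, hj]
  · simp [koverride, ha]

/-- The loss of value of `o` caused by one greedy step. -/
theorem koverride_sub_le [Fintype V] (hk : 2 ≤ k) {f : (V → Fin (k+1)) → ℝ} (hsub : KSubmodular f)
    (c : V → ℝ) (o : V → Fin (k+1)) {x : V → Fin (k+1)} {e : V} (he : x e = 0)
    {j : Fin (k+1)} (hj : j ≠ 0)
    (hmax : ∀ j' : Fin (k+1), j' ≠ 0 → margin f x e j' ≤ margin f x e j)
    {ρ : ℝ} (hρ : ρ * c e ≤ margin f x e j) :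
    f (koverride o x) - f (koverride o (Function.update x e j)) ≤
      2 * margin f x e j -
        ρ * (kcost c (koverride o (Function.update x e j)) - kcost c (koverride o x)) := by
  have hle := kle_koverride o x
  have hoe : koverride o x e = o e := by simp [koverride, he]
  rw [koverride_update o x e hj]
  set y := koverride o x
  by_cases ho : o e = 0
  · have hy : y e = 0 := hoe.trans ho
    obtain ⟨i, hi, hij⟩ := exists_ne_zero_ne hk j
    have h1 := margin_add_margin_nonneg hsub hy hi hj hij
    have h2 := margin_anti hsub hle hy i
    have h3 := hmax i hi
    rw [kcost_update c hy hj]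
    have h4 : margin f y e j = f (Function.update y e j) - f y := rfl
    linarith
  · have hz : Function.update y e 0 e = 0 := Function.update_self ..
    have hyz : y = Function.update (Function.update y e 0) e (o e) := by
      rw [Function.update_idem, ← hoe, Function.update_eq_self]
    have hjz : Function.update y e j = Function.update (Function.update y e 0) e j := by
      rw [Function.update_idem]
    have hxz : kle x (Function.update y e 0) := by
      intro a
      by_cases ha : a = e
      · subst ha; exact Or.inl he
      · simpa [ha] using hle a
    have hnonneg := margin_nonneg_of_max hk hsub he hj hmax
    rw [hjz]
    generalize Function.update y e 0 = z at *
    rw [hyz, kcost_update c hz hj, kcost_update c hz ho]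
    by_cases hij : o e = j
    · rw [hij]; linarith
    · have h1 := margin_add_margin_nonneg hsub hz ho hj hij
      have h2 := margin_anti hsub hxz hz (o e)
      have h3 := hmax (o e) ho
      have h4 : margin f z e j = f (Function.update z e j) - f z := rfl
      have h5 : margin f z e (o e) = f (Function.update z e (o e)) - f z := rfl
      linarith

theorem GreedyStep.kle {f : (V → Fin (k+1)) → ℝ} {c : V → ℝ} {o x x' : V → Fin (k+1)}
    (h : GreedyStep f c o x x') : kle x x' := by
  obtain ⟨e, j, he, -, rfl, -, -⟩ := h
  intro a
  by_cases ha : a = e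
  · subst ha; exact Or.inl he
  · simp [ha]

theorem kle_of_greedyStep {f : (V → Fin (k+1)) → ℝ} {c : V → ℝ} {o : V → Fin (k+1)}
    {m : ℕ} {s : ℕ → V → Fin (k+1)} (hstep : ∀ i < m, GreedyStep f c o (s i) (s (i+1)))
    {i n : ℕ} (hin : i ≤ n) (hn : n ≤ m) : kle (s i) (s n) := by
  induction n, hin using Nat.le_induction with
  | base => exact fun e => Or.inr rfl
  | succ n hin ih => exact (ih (by omega)).trans (hstep n (by omega)).kle

/-- The smallest density of a step bounds the final marginal densities towards `o`. -/
theorem exists_density_bound [Fintype V] (hk : 2 ≤ k) {f : (V → Fin (k+1)) → ℝ} (hsub : KSubmodular f)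
    {c : V → ℝ} (hc : ∀ e : V, 0 < c e) {o : V → Fin (k+1)} {m : ℕ} (hm : 0 < m)
    {s : ℕ → V → Fin (k+1)} (hstep : ∀ i < m, GreedyStep f c o (s i) (s (i+1))) :
    ∃ ρ : ℝ, 0 ≤ ρ ∧
      (∀ i < m, ρ * (kcost c (s (i+1)) - kcost c (s i)) ≤ f (s (i+1)) - f (s i)) ∧
      ∀ e, o e ≠ 0 → s m e = 0 → margin f (s m) e (o e) ≤ ρ * c e := by
  obtain ⟨i, hi, hmin⟩ := Finset.exists_min_image (Finset.range m)
    (fun i => (f (s (i+1)) - f (s i)) / (kcost c (s (i+1)) - kcost c (s i)))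
    ⟨0, Finset.mem_range.2 hm⟩
  rw [Finset.mem_range] at hi
  have hcost : ∀ n < m, 0 < kcost c (s (n+1)) - kcost c (s n) := by
    intro n hn
    obtain ⟨e, j, he, hj, hs, -, -⟩ := hstep n hn
    rw [hs, kcost_update c he hj]
    linarith [hc e]
  refine ⟨_, ?_, fun n hn => (le_div_iff₀ (hcost n hn)).1 (hmin n (Finset.mem_range.2 hn)), ?_⟩
  · refine div_nonneg ?_ (hcost i hi).le
    obtain ⟨e, j, he, hj, hs, hmax, -⟩ := hstep i hi
    rw [hs]
    exact margin_nonneg_of_max hk hsub he hj hmax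
  · intro a hoa hsa
    have hle := kle_of_greedyStep hstep hi.le le_rfl
    have hia : s i a = 0 := by rcases hle a with h | h <;> simp [h, hsa]
    refine (margin_anti hsub hle hsa (o a)).trans ?_
    obtain ⟨e, j, he, hj, hs, -, hbest⟩ := hstep i hi
    have h := hbest a hoa hia (o a) hoa
    rw [hs, kcost_update c he hj, add_sub_cancel_left, div_mul_eq_mul_div, le_div_iff₀ (hc e)]
    exact h

end GreedyRatio

/-- For `k ≥ 2` and a nonnegative (not necessarily monotone) `k`-submodular `f`
with `f(0)=0`: if `s` is obtained by a greedy sequence (relative to `o`) starting from `0`,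
`c(o) > 0` and `β = c(s)/c(o)`, then `f(s) ≥ min{β/3, 1/3}·f(o)`. -/
theorem greedy_ratio_lemma_nonmonotone
    {V : Type*} [Fintype V] [DecidableEq V] {k : ℕ} (hk : 2 ≤ k)
    (f : (V → Fin (k+1)) → ℝ)
    (hsub : KSubmodular f)
    (hnonneg : ∀ x : V → Fin (k+1), 0 ≤ f x) (hzero : f (fun _ => 0) = 0)
    (c : V → ℝ) (hc : ∀ e : V, 0 < c e)
    (o : V → Fin (k+1)) (hco : 0 < kcost c o)
    (m : ℕ) (s : ℕ → V → Fin (k+1))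
    (h0 : s 0 = fun _ => 0)
    (hstep : ∀ i < m, GreedyStep f c o (s i) (s (i+1)))
    (β : ℝ) (hβ : β = kcost c (s m) / kcost c o) :
    min (β / 3) (1 / 3) * f o ≤ f (s m) := by
  have hcost0 : kcost c (s 0) = 0 := by simp [kcost, ksupp, h0]
  rcases Nat.eq_zero_or_pos m with rfl | hm
  · have hβ0 : β = 0 := by rw [hβ, hcost0, zero_div]
    have hmin : min (β / 3) (1 / 3 : ℝ) = 0 := by rw [hβ0]; norm_num
    rw [hmin, zero_mul]
    exact hnonneg _
  obtain ⟨ρ, hρ, hdens, hfin⟩ := exists_density_bound hk hsub hc hm hstep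
  have hinv : ∀ n ≤ m, ρ * kcost c (s n) ≤ f (s n) ∧
      f o - f (koverride o (s n)) ≤
        2 * f (s n) - ρ * (kcost c (koverride o (s n)) - kcost c o) := by
    intro n
    induction n with
    | zero =>
      intro _
      have h : koverride o (s 0) = o := by funext e; simp [koverride, h0]
      rw [h, hcost0, h0, hzero]
      simp
    | succ n ih =>
      intro hn
      obtain ⟨ih1, ih2⟩ := ih (by omega)
      have hd := hdens n hn
      obtain ⟨e, j, he, hj, hs, hmax, -⟩ := hstep n hn
      refine ⟨by linarith, ?_⟩
      have hρe : ρ * c e ≤ margin f (s n) e j := by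
        rwa [hs, kcost_update c he hj, add_sub_cancel_left] at hd
      have h := koverride_sub_le hk hsub c o he hj hmax hρe
      rw [margin, ← hs] at h
      linarith
  obtain ⟨hs1, hs2⟩ := hinv m le_rfl
  have hgain : f (koverride o (s m)) ≤
      f (s m) + ρ * (kcost c (koverride o (s m)) - kcost c (s m)) := by
    refine le_add_mul_kcost_sub hsub c (kle_koverride o (s m)) fun e he hoe => ?_
    have h : koverride o (s m) e = o e := by simp [koverride, he]
    rw [h] at hoe ⊢
    exact hfin e hoe he
  have hmain : f o ≤ 3 * f (s m) + ρ * (kcost c o - kcost c (s m)) := by linarith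
  have hfo := hnonneg o
  rcases le_total (kcost c o) (kcost c (s m)) with hle | hle
  · have h1 : min (β / 3) (1 / 3) * f o ≤ 1 / 3 * f o :=
      mul_le_mul_of_nonneg_right (min_le_right _ _) hfo
    have h2 : ρ * (kcost c o - kcost c (s m)) ≤ 0 :=
      mul_nonpos_of_nonneg_of_nonpos hρ (by linarith)
    linarith
  · refine (mul_le_mul_of_nonneg_right (min_le_left _ _) hfo).trans ?_
    have hcs : 0 ≤ kcost c (s m) := Finset.sum_nonneg fun e _ => (hc e).le
    have h1 := mul_le_mul_of_nonneg_right hmain hcs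
    have h2 := mul_le_mul_of_nonneg_right hs1 (sub_nonneg.2 hle)
    have h3 := mul_nonneg (hnonneg (s m)) (sub_nonneg.2 hle)
    have h4 : kcost c (s m) * f o ≤ 3 * f (s m) * kcost c o := by linarith
    rw [hβ, div_div, div_mul_eq_mul_div, div_le_iff₀ (by positivity)]
    linarith
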